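/- Let k be an algebraically closed field and let X ⊆ P^3_k be a singular irreducible cubic hypersurface. Then there exists an automorphism φ of the variety P^3_k \ X that does not extend to an automorphism of P^3_k. -/

import Mathlib

/-!
Common set-up: projective `n`-space over a field `k` as the scheme
`Proj k[x_0, …, x_n]`, complements of hypersurfaces as open subschemes,
hypersurfaces as reduced closed subschemes, and isomorphisms of varieties
over `k` as scheme isomorphisms commuting with the structure morphisms
to `Spec k`.
-/

open AlgebraicGeometry CategoryTheory MvPolynomial

attribute [local instance] MvPolynomial.gradedAlgebra

noncomputable section

/-- The standard grading on the polynomial ring `k[x_0, …, x_n]`. -/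
abbrev grading (k : Type) [Field k] (n : ℕ) := homogeneousSubmodule (Fin (n + 1)) k

/-- Projective `n`-space over `k`, as a scheme. -/
abbrev ProjSpace (k : Type) [Field k] (n : ℕ) : Scheme := Proj (grading k n)

/-- The base scheme `Spec k`. -/
abbrev SpecK (k : Type) [Field k] : Scheme := Spec (CommRingCat.of k)

/-- The structure morphism `ℙⁿ_k ⟶ Spec k`. -/
abbrev projStruct (k : Type) [Field k] (n : ℕ) : ProjSpace k n ⟶ SpecK k :=
  Proj.toSpecZero (grading k n) ≫
    Spec.map (CommRingCat.ofHom (algebraMap k ((grading k n) 0)))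

/-- The open complement `ℙⁿ_f = ℙⁿ ∖ V(f)` of the hypersurface `V(f)`, as a scheme. -/
abbrev PnF (k : Type) [Field k] (n : ℕ) (f : MvPolynomial (Fin (n + 1)) k) : Scheme :=
  (Proj.basicOpen (grading k n) f).toScheme

/-- The structure morphism `ℙⁿ_f ⟶ Spec k`. -/
abbrev PnFStruct (k : Type) [Field k] (n : ℕ) (f : MvPolynomial (Fin (n + 1)) k) :
    PnF k n f ⟶ SpecK k :=
  (Proj.basicOpen (grading k n) f).ι ≫ projStruct k n

/-- Two schemes equipped with structure morphisms to a common base are isomorphic over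
that base.  For varieties over `k` (with base `Spec k`) this is the usual notion of
isomorphism of varieties over `k`. -/
def IsoOver {X Y B : Scheme} (sX : X ⟶ B) (sY : Y ⟶ B) : Prop :=
  ∃ e : X ≅ Y, e.hom ≫ sY = sX

/-- The set of points of `ℙⁿ` where `f` vanishes. -/
def zeroLocusSet (k : Type) [Field k] (n : ℕ) (f : MvPolynomial (Fin (n + 1)) k) :
    Set (ProjSpace k n) :=
  {x | f ∈ (x : ProjectiveSpectrum (grading k n)).asHomogeneousIdeal}

/-- `ι : H ⟶ ℙⁿ` realizes the scheme `H` as the hypersurface `V(f) ⊆ ℙⁿ`, i.e. as the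
reduced closed subscheme of `ℙⁿ` whose underlying set is the zero locus of `f`. -/
structure IsHypersurface {k : Type} [Field k] {n : ℕ} (f : MvPolynomial (Fin (n + 1)) k)
    (H : Scheme) (ι : H ⟶ ProjSpace k n) : Prop where
  isClosedImmersion : IsClosedImmersion ι
  reduced : IsReduced H
  range_eq : Set.range ι.base = zeroLocusSet k n f

section Geometry

variable {σ A : Type} [CommRing A] [SetLike σ A] [AddSubgroupClass σ A] {𝒜 : ℕ → σ} [GradedRing 𝒜]

/-- A homogeneous prime element defines a point of `Proj`. -/
theorem exists_mem_proj_of_prime {f l : A} {d : ℕ} (hf : Prime f) (hfd : f ∈ 𝒜 d)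
    (hl : l ∈ 𝒜 1) (hfl : ¬ f ∣ l) :
    ∃ x : Proj 𝒜, x ∉ Proj.basicOpen 𝒜 f ∧ x ∈ Proj.basicOpen 𝒜 l := by
  let I : HomogeneousIdeal 𝒜 := ⟨Ideal.span {f}, Ideal.homogeneous_span 𝒜 _ (by
    rintro _ rfl; exact ⟨d, hfd⟩)⟩
  have hI (a : A) : a ∈ I ↔ f ∣ a := Ideal.mem_span_singleton
  refine ⟨(⟨I, (Ideal.span_singleton_prime hf.ne_zero).2 hf, fun h => hfl ((hI l).1 (h ?_))⟩ :
    ProjectiveSpectrum 𝒜), ?_, ?_⟩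
  · rw [HomogeneousIdeal.mem_irrelevant_iff]
    exact DirectSum.decompose_of_mem_ne 𝒜 hl one_ne_zero
  · exact fun h => h ((hI f).2 dvd_rfl)
  · exact fun h => hfl ((hI l).1 h)

theorem exists_basicOpen_le_preimage {f l : A} {d : ℕ} (hf : Prime f) (hfd : f ∈ 𝒜 d)
    (hl : l ∈ 𝒜 1) (hfl : ¬ f ∣ l)
    (φ : (Proj.basicOpen 𝒜 f).toScheme ⟶ (Proj.basicOpen 𝒜 f).toScheme)
    (Φ : Proj 𝒜 ≅ Proj 𝒜)
    (h : (Proj.basicOpen 𝒜 f).ι ≫ Φ.hom = φ ≫ (Proj.basicOpen 𝒜 f).ι) :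
    ∃ n g, 0 < n ∧ g ∈ 𝒜 n ∧ ¬ f ∣ g ∧ Proj.basicOpen 𝒜 g ≤ Φ.hom ⁻¹ᵁ Proj.basicOpen 𝒜 l := by
  obtain ⟨x, hxf, hxl⟩ := exists_mem_proj_of_prime hf hfd hl hfl
  set p := Φ.inv x with hp
  have hpx : Φ.hom p = x := by simp [hp, ← Scheme.Hom.comp_apply]
  have hpf : p ∉ Proj.basicOpen 𝒜 f := fun hpf => hxf <| by
    obtain ⟨p', hp'⟩ : p ∈ Set.range (Proj.basicOpen 𝒜 f).ι := by
      rwa [Scheme.Opens.range_ι]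
    rw [← hpx, ← hp', ← Scheme.Hom.comp_apply, h, Scheme.Hom.comp_apply]
    exact (φ p').2
  have hpl : p ∈ Φ.hom ⁻¹ᵁ Proj.basicOpen 𝒜 l := by
    change Φ.hom p ∈ Proj.basicOpen 𝒜 l
    rwa [hpx]
  obtain ⟨_, ⟨g, rfl⟩, hpg, hg⟩ :=
    TopologicalSpace.Opens.isBasis_iff_nbhd.1 (Proj.isBasis_basicOpen 𝒜) hpl
  rw [Proj.basicOpen_eq_iSup_proj, TopologicalSpace.Opens.mem_iSup] at hpg
  obtain ⟨i, hi⟩ := hpg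
  refine ⟨i + 1, GradedRing.proj 𝒜 i g * l, by simp, ?_, ?_, ?_⟩
  · exact SetLike.mul_mem_graded (SetLike.coe_mem _) hl
  · rw [hf.dvd_mul, not_or]
    refine ⟨fun hdvd => ?_, hfl⟩
    have hi' : GradedRing.proj 𝒜 i g ∉ p.asHomogeneousIdeal := hi
    have hpf' : f ∈ p.asHomogeneousIdeal := not_not.1 hpf
    exact hi' (Ideal.mem_of_dvd p.asHomogeneousIdeal.toIdeal hdvd hpf')
  · refine (Proj.basicOpen_mono 𝒜 _ _ (dvd_mul_right _ _)).trans (le_trans ?_ hg)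
    rw [Proj.basicOpen_eq_iSup_proj _ g]
    exact le_iSup (fun i => Proj.basicOpen 𝒜 (GradedRing.proj 𝒜 i g)) i

open HomogeneousLocalization in
theorem exists_away_ringHom {f l g : A} {d e n : ℕ} (hfd : f ∈ 𝒜 d) (hd : 0 < d)
    (hl : l ∈ 𝒜 e) (he : 0 < e) (hg : g ∈ 𝒜 n) (hn : 0 < n)
    (τ : Away 𝒜 f →+* Away 𝒜 f) (Φ : Proj 𝒜 ⟶ Proj 𝒜)
    (hΦ : Proj.awayι 𝒜 f hfd hd ≫ Φ = Spec.map (CommRingCat.ofHom τ) ≫ Proj.awayι 𝒜 f hfd hd)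
    (hle : Proj.basicOpen 𝒜 g ≤ Φ ⁻¹ᵁ Proj.basicOpen 𝒜 l) :
    ∃ (ψ : Away 𝒜 l →+* Away 𝒜 g) (θ : Away 𝒜 (l * f) →+* Away 𝒜 (g * f)),
      (∀ a, θ (awayMap 𝒜 hfd rfl a) = awayMap 𝒜 hfd rfl (ψ a)) ∧
      ∀ a, θ (awayMap 𝒜 hl (mul_comm l f) a) = awayMap 𝒜 hg (mul_comm g f) (τ a) := by
  have hrange : Set.range (Proj.awayι 𝒜 g hg hn ≫ Φ) ⊆ Set.range (Proj.awayι 𝒜 l hl he) := by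
    rintro _ ⟨x, rfl⟩
    have h1 : Proj.awayι 𝒜 g hg hn x ∈ (Proj.awayι 𝒜 g hg hn).opensRange := ⟨x, rfl⟩
    rw [Proj.opensRange_awayι] at h1
    have h2 : (Proj.awayι 𝒜 g hg hn ≫ Φ) x ∈ Proj.basicOpen 𝒜 l := hle h1
    rwa [← Proj.opensRange_awayι 𝒜 l hl he] at h2
  set Ψ := IsOpenImmersion.lift (Proj.awayι 𝒜 l hl he) _ hrange
  have hΨ : Ψ ≫ Proj.awayι 𝒜 l hl he = Proj.awayι 𝒜 g hg hn ≫ Φ := IsOpenImmersion.lift_fac _ _ _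
  obtain ⟨ψ, hψ⟩ : ∃ ψ, Spec.map ψ = Ψ := Spec.map_surjective Ψ
  have hcomp : (Spec.map (CommRingCat.ofHom (awayMap 𝒜 hfd (rfl : g * f = _))) ≫ Spec.map ψ) ≫
        Proj.awayι 𝒜 l hl he =
      (Spec.map (CommRingCat.ofHom (awayMap 𝒜 hg (mul_comm g f))) ≫
        Spec.map (CommRingCat.ofHom τ)) ≫ Proj.awayι 𝒜 f hfd hd := by
    rw [Category.assoc, Category.assoc, hψ, hΨ, ← hΦ,
      Proj.SpecMap_awayMap_awayι_assoc, Proj.SpecMap_awayMap_awayι_assoc]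
    rfl
  set Θ := Limits.pullback.lift _ _ hcomp ≫
    (Proj.pullbackAwayιIso 𝒜 hl he hfd hd (rfl : l * f = _)).hom
  obtain ⟨θ, hθ⟩ : ∃ θ, Spec.map θ = Θ := Spec.map_surjective Θ
  refine ⟨ψ.hom, θ.hom, fun a => ?_, fun a => ?_⟩
  · have : CommRingCat.ofHom (awayMap 𝒜 hfd (rfl : l * f = _)) ≫ θ =
        ψ ≫ CommRingCat.ofHom (awayMap 𝒜 hfd (rfl : g * f = _)) := by
      apply Spec.map_injective
      rw [Spec.map_comp, Spec.map_comp, hθ]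
      simp only [Θ, Category.assoc, Proj.pullbackAwayιIso_hom_SpecMap_awayMap_left]
      exact Limits.pullback.lift_fst _ _ _
    exact congr_arg (fun φ => φ a) this
  · have : CommRingCat.ofHom (awayMap 𝒜 hl (mul_comm l f)) ≫ θ =
        CommRingCat.ofHom τ ≫ CommRingCat.ofHom (awayMap 𝒜 hg (mul_comm g f)) := by
      apply Spec.map_injective
      rw [Spec.map_comp, Spec.map_comp, hθ]
      simp only [Θ, Category.assoc, Proj.pullbackAwayιIso_hom_SpecMap_awayMap_right]
      exact Limits.pullback.lift_snd _ _ _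
    exact congr_arg (fun φ => φ a) this

open HomogeneousLocalization in
theorem not_extends [IsDomain A] {f l m b : A} (hf : Prime f) (hfd : f ∈ 𝒜 3)
    (hl : l ∈ 𝒜 1) (hfl : ¬ f ∣ l) (hm : m ∈ 𝒜 1) (hfb : ¬ f ∣ b)
    (τ : Away 𝒜 f →+* Away 𝒜 f)
    (hl3 : l ^ 3 ∈ 𝒜 (1 • 3)) (hml : m * l ^ 2 ∈ 𝒜 (1 • 3)) (hbl : (f * m + b) * l ^ 2 ∈ 𝒜 (2 • 3))
    (hτl : τ (Away.mk 𝒜 hfd 1 (l ^ 3) hl3) = Away.mk 𝒜 hfd 1 (l ^ 3) hl3)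
    (hτm : τ (Away.mk 𝒜 hfd 1 (m * l ^ 2) hml) = Away.mk 𝒜 hfd 2 ((f * m + b) * l ^ 2) hbl)
    (φ : (Proj.basicOpen 𝒜 f).toScheme ⟶ (Proj.basicOpen 𝒜 f).toScheme)
    (hφ : (Proj.basicOpenIsoSpec 𝒜 f hfd three_pos).inv ≫ φ =
      Spec.map (CommRingCat.ofHom τ) ≫ (Proj.basicOpenIsoSpec 𝒜 f hfd three_pos).inv)
    (Φ : Proj 𝒜 ≅ Proj 𝒜) :
    (Proj.basicOpen 𝒜 f).ι ≫ Φ.hom ≠ φ ≫ (Proj.basicOpen 𝒜 f).ι := by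
  intro h
  obtain ⟨n, g, hn, hg, hfg, hle⟩ := exists_basicOpen_le_preimage hf hfd hl hfl φ Φ h
  obtain ⟨ψ, θ, h1, h2⟩ := exists_away_ringHom hfd three_pos hl one_pos hg hn τ Φ.hom (by
    rw [Proj.awayι, Category.assoc, h, reassoc_of% hφ]) hle
  have hm' : m ∈ 𝒜 (1 • 1) := hm
  obtain ⟨N, c, hc, hψ⟩ := Away.mk_surjective 𝒜 hg (ψ (Away.mk 𝒜 hl 1 m hm'))
  have key : awayMap 𝒜 hfd (rfl : l * f = _) (Away.mk 𝒜 hl 1 m hm') *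
      awayMap 𝒜 hl (mul_comm l f) (Away.mk 𝒜 hfd 1 (l ^ 3) hl3) =
      awayMap 𝒜 hl (mul_comm l f) (Away.mk 𝒜 hfd 1 (m * l ^ 2) hml) := by
    ext
    simp only [awayMap_mk, val_mul, Away.val_mk, Localization.mk_mul]
    rw [Localization.mk_eq_mk_iff, Localization.r_iff_exists]
    refine ⟨1, ?_⟩
    simp only [Submonoid.coe_mul, Submonoid.coe_one]
    ring
  have key' := congr_arg θ key
  rw [map_mul, h1, h2, h2, hτl, hτm, ← hψ] at key'
  apply_fun HomogeneousLocalization.val at key'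
  simp only [awayMap_mk, val_mul, Away.val_mk, Localization.mk_mul] at key'
  rw [Localization.mk_eq_mk_iff, Localization.r_iff_exists] at key'
  obtain ⟨⟨_, j, rfl⟩, hj⟩ := key'
  simp only [Submonoid.coe_mul] at hj
  have hf0 := hf.ne_zero
  have hl0 : l ≠ 0 := fun h => hfl (h ▸ dvd_zero f)
  have hg0 : g ≠ 0 := fun h => hfg (h ▸ dvd_zero f)
  have hj' : (f * g) ^ j * f ^ (N + 1) * g ^ 3 * l ^ 2 * (c * l * f) =
      (f * g) ^ j * f ^ (N + 1) * g ^ 3 * l ^ 2 * ((f * m + b) * g ^ N) := by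
    linear_combination hj
  have hz : (f * g) ^ j * f ^ (N + 1) * g ^ 3 * l ^ 2 ≠ 0 := by simp [hf0, hl0, hg0]
  have hd : f ∣ (f * m + b) * g ^ N := ⟨c * l, by linear_combination - mul_left_cancel₀ hz hj'⟩
  rcases hf.dvd_or_dvd hd with hd | hd
  · exact hfb ((dvd_add_right (dvd_mul_right f m)).1 hd)
  · exact hfg (hf.dvd_of_dvd_pow hd)

end Geometry

open HomogeneousLocalization in
theorem exists_away_ringEquiv {σ A : Type} [CommRing A] [SetLike σ A] [AddSubgroupClass σ A]
    {𝒜 : ℕ → σ} [GradedRing 𝒜] {f : A} (S : Localization.Away f ≃+* Localization.Away f)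
    (h : ∀ a : Away 𝒜 f, ∃ b : Away 𝒜 f, b.val = S a.val)
    (h' : ∀ a : Away 𝒜 f, ∃ b : Away 𝒜 f, b.val = S.symm a.val) :
    ∃ τ : Away 𝒜 f ≃+* Away 𝒜 f, ∀ a, (τ a).val = S a.val := by
  choose F hF using h
  choose G hG using h'
  refine ⟨{ toFun := F, invFun := G, left_inv := fun a => ?_, right_inv := fun a => ?_,
            map_mul' := fun a b => ?_, map_add' := fun a b => ?_ }, hF⟩ <;>
  · apply val_injective
    simp [hF, hG]

section Fractions

variable {k σ : Type} [Field k] {f : MvPolynomial σ k}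

/-- The degree `d` part of the localization of a polynomial ring at a cubic form `f`. -/
def fractionsOfDegree (hf : f.IsHomogeneous 3) (d : ℕ) : Submodule k (Localization.Away f) where
  carrier := {u | ∃ n a, a.IsHomogeneous (d + 3 * n) ∧
    u * algebraMap _ _ (f ^ n) = algebraMap (MvPolynomial σ k) _ a}
  zero_mem' := ⟨0, 0, isHomogeneous_zero _ _ _, by simp⟩
  add_mem' := by
    rintro u v ⟨n, a, ha, hu⟩ ⟨m, b, hb, hv⟩
    refine ⟨n + m, a * f ^ m + b * f ^ n, ?_, ?_⟩
    · refine IsHomogeneous.add ?_ ?_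
      · convert! ha.mul (hf.pow m) using 1; ring
      · convert! hb.mul (hf.pow n) using 1; ring
    · simp only [map_add, map_mul, map_pow] at hu hv ⊢
      linear_combination algebraMap _ _ f ^ m * hu + algebraMap _ _ f ^ n * hv
  smul_mem' := by
    rintro c u ⟨n, a, ha, hu⟩
    refine ⟨n, C c * a, ha.C_mul c, ?_⟩
    rw [Algebra.smul_mul_assoc, hu, Algebra.smul_def, map_mul]
    rfl

variable {hf : f.IsHomogeneous 3}

theorem mul_mem_fractionsOfDegree {d e : ℕ} {u v : Localization.Away f}
    (hu : u ∈ fractionsOfDegree hf d) (hv : v ∈ fractionsOfDegree hf e) :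
    u * v ∈ fractionsOfDegree hf (d + e) := by
  obtain ⟨n, a, ha, hu⟩ := hu
  obtain ⟨m, b, hb, hv⟩ := hv
  refine ⟨n + m, a * b, ?_, ?_⟩
  · convert! ha.mul hb using 1; ring
  · simp only [map_mul, map_pow] at hu hv ⊢
    rw [← hu, ← hv]; ring

theorem algebraMap_mem_fractionsOfDegree {d : ℕ} {a : MvPolynomial σ k} (ha : a.IsHomogeneous d) :
    algebraMap _ _ a ∈ fractionsOfDegree hf d :=
  ⟨0, a, ha, by simp⟩

instance : SetLike.GradedMonoid (fractionsOfDegree hf) where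
  one_mem := by
    simpa using algebraMap_mem_fractionsOfDegree (hf := hf) (isHomogeneous_one σ k)
  mul_mem _ _ _ _ hu hv := mul_mem_fractionsOfDegree hu hv

theorem aeval_mem_fractionsOfDegree {τ : Type} {G : τ → Localization.Away f}
    (hG : ∀ i, G i ∈ fractionsOfDegree hf 1) {p : MvPolynomial τ k} {d : ℕ}
    (hp : p.IsHomogeneous d) : aeval G p ∈ fractionsOfDegree hf d := by
  rw [aeval_def, eval₂_eq]
  refine Submodule.sum_mem _ fun s hs => ?_
  rw [← Algebra.smul_def]
  refine Submodule.smul_mem _ _ ?_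
  convert! SetLike.prod_pow_mem_graded (fractionsOfDegree hf) (fun _ => 1) G s
    (F := s.support) (fun i _ => hG i) using 1
  rw [hp.degree_eq_sum_deg_support hs]
  simp

/-- A fraction of degree zero is an element of the homogeneous localization. -/
theorem exists_val_eq {u : Localization.Away f} (hu : u ∈ fractionsOfDegree hf 0) :
    ∃ b : HomogeneousLocalization.Away (homogeneousSubmodule σ k) f, b.val = u := by
  obtain ⟨n, a, ha, hu⟩ := hu
  refine ⟨HomogeneousLocalization.Away.mk (homogeneousSubmodule σ k)
    ((mem_homogeneousSubmodule 3 f).2 hf) n a ?_, ?_⟩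
  · rw [mem_homogeneousSubmodule]
    convert! ha using 1
    simp [mul_comm]
  · rw [HomogeneousLocalization.Away.val_mk, Localization.mk_eq_mk', IsLocalization.mk'_eq_iff_eq_mul]
    exact hu.symm

theorem val_mem_fractionsOfDegree
    (b : HomogeneousLocalization.Away (homogeneousSubmodule σ k) f) :
    b.val ∈ fractionsOfDegree hf 0 := by
  obtain ⟨n, a, ha, rfl⟩ := HomogeneousLocalization.Away.mk_surjective _
    ((mem_homogeneousSubmodule 3 f).2 hf) b
  refine ⟨n, a, ?_, ?_⟩
  · rw [mem_homogeneousSubmodule] at ha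
    convert! ha using 1
    simp [mul_comm]
  · rw [HomogeneousLocalization.Away.val_mk, Localization.mk_eq_mk']
    exact IsLocalization.mk'_spec _ a (⟨f ^ n, n, rfl⟩ : Submonoid.powers f)

theorem MvPolynomial.IsHomogeneous.of_mul_left {q b : MvPolynomial σ k} {e d : ℕ}
    (hq : q.IsHomogeneous e) (hq0 : q ≠ 0) (h : (q * b).IsHomogeneous (d + e)) :
    b.IsHomogeneous d := by
  rw [← mem_homogeneousSubmodule] at hq h
  have h1 := DirectSum.coe_decompose_mul_of_left_mem_of_le (homogeneousSubmodule σ k) (b := b)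
    (n := d + e) hq (Nat.le_add_left _ _)
  rw [DirectSum.decompose_of_mem_same (homogeneousSubmodule σ k) h, Nat.add_sub_cancel] at h1
  rw [mul_left_cancel₀ hq0 h1]
  exact (mem_homogeneousSubmodule d _).1 (SetLike.coe_mem _)

theorem mem_fractionsOfDegree_of_mul {q : MvPolynomial σ k} {e d : ℕ} {u : Localization.Away f}
    (hf0 : f ≠ 0) (hq : q.IsHomogeneous e) (hq0 : q ≠ 0)
    (h : algebraMap _ _ q * u ∈ fractionsOfDegree hf (d + e)) : u ∈ fractionsOfDegree hf d := by
  have hle : Submonoid.powers f ≤ nonZeroDivisors _ := powers_le_nonZeroDivisors_of_noZeroDivisors hf0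
  obtain ⟨n, a, ha, hu⟩ := h
  obtain ⟨⟨b, ⟨_, m, rfl⟩⟩, hb⟩ := IsLocalization.surj (Submonoid.powers f) u
  refine ⟨n + m, b * f ^ n, hq.of_mul_left hq0 (d := d + 3 * (n + m)) ?_, ?_⟩
  · have : q * (b * f ^ n) = a * f ^ m := by
      apply IsLocalization.injective (Localization.Away f) hle
      simp only [map_mul, map_pow] at hu hb ⊢
      rw [← hu, ← hb]; ring
    rw [this]
    convert! ha.mul (hf.pow m) using 1; ring
  · simp only [map_mul, map_pow] at hu hb ⊢
    rw [← hb]; ring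

end Fractions

section Shear

variable {k σ : Type} [Field k] {f f' : MvPolynomial σ k}

/-- A point of the localization at a form `f`, on which `f` (in suitable coordinates) takes the
value `f`, defines an endomorphism of the localization. -/
theorem exists_algHom_of_point (hf : f.IsHomogeneous 3) (L : MvPolynomial σ k ≃ₐ[k] MvPolynomial σ k)
    (hL : L f' = f) (hL' : ∀ i, (L.symm (X i)).IsHomogeneous 1) {G : σ → Localization.Away f}
    (hG : ∀ i, G i ∈ fractionsOfDegree hf 1) (hGf : aeval G f' = algebraMap _ _ f) :
    ∃ T : Localization.Away f →ₐ[k] Localization.Away f,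
      (∀ p, T (algebraMap _ _ (L p)) = aeval G p) ∧
      ∀ u ∈ fractionsOfDegree hf 0, T u ∈ fractionsOfDegree hf 0 := by
  have hf' : L.symm f = f' := by rw [← hL, AlgEquiv.symm_apply_apply]
  let s : MvPolynomial σ k →ₐ[k] Localization.Away f := (aeval G).comp L.symm.toAlgHom
  have hsf : s f = algebraMap _ _ f := by
    change aeval G (L.symm f) = _
    rw [hf', hGf]
  have hs {p : MvPolynomial σ k} {d : ℕ} (hp : p.IsHomogeneous d) : s p ∈ fractionsOfDegree hf d := by
    refine aeval_mem_fractionsOfDegree hG ?_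
    have := hp.aeval (φ := p) (fun i => L.symm (X i)) hL'
    rw [one_mul] at this
    convert! this using 1
    exact DFunLike.congr_fun (aeval_unique L.symm.toAlgHom) p
  have hu : IsUnit (s f) := hsf ▸ IsLocalization.Away.algebraMap_isUnit f
  have hval (p : MvPolynomial σ k) :
      IsLocalization.Away.liftAlgHom (S := Localization.Away f) f hu (algebraMap _ _ p) = s p :=
    IsLocalization.Away.lift_eq f hu p
  refine ⟨IsLocalization.Away.liftAlgHom (S := Localization.Away f) f hu, fun p => ?_, ?_⟩
  · rw [hval]
    exact congr_arg (aeval G) (L.symm_apply_apply p)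
  · rintro u ⟨n, a, ha, hua⟩
    have h := congr_arg (IsLocalization.Away.liftAlgHom (S := Localization.Away f) f hu) hua
    rw [map_mul, hval, hval, map_pow, hsf] at h
    obtain ⟨m, b, hb, hab⟩ := hs ha
    refine ⟨n + m, b, ?_, ?_⟩
    · convert! hb using 1; ring
    · rw [pow_add, map_mul, ← mul_assoc, map_pow _ f n, h, hab]

/-- A family of points of the localization at `f` gives automorphisms of the localization as
soon as the endomorphisms with opposite parameters undo each other on coordinates. -/
theorem exists_algEquiv_of_family (hf : f.IsHomogeneous 3)
    (L : MvPolynomial σ k ≃ₐ[k] MvPolynomial σ k)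
    (hL : L f' = f) (hL' : ∀ i, (L.symm (X i)).IsHomogeneous 1) {G : k → σ → Localization.Away f}
    (hG : ∀ s i, G s i ∈ fractionsOfDegree hf 1) (hGf : ∀ s, aeval (G s) f' = algebraMap _ _ f)
    (hGG : ∀ s (T : Localization.Away f →ₐ[k] Localization.Away f),
      (∀ p, T (algebraMap _ _ (L p)) = aeval (G s) p) →
      ∀ i, T (G (-s) i) = algebraMap _ _ (L (X i))) :
    ∃ S : Localization.Away f ≃ₐ[k] Localization.Away f,
      (∀ p, S (algebraMap _ _ (L p)) = aeval (G 1) p) ∧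
      (∀ u ∈ fractionsOfDegree hf 0, S u ∈ fractionsOfDegree hf 0) ∧
      ∀ u ∈ fractionsOfDegree hf 0, S.symm u ∈ fractionsOfDegree hf 0 := by
  choose T hT hT' using fun s => exists_algHom_of_point hf L hL hL' (hG s) (hGf s)
  have key (s : k) : (T s).comp (T (-s)) = AlgHom.id k _ := by
    apply IsLocalization.algHom_ext (Submonoid.powers f)
    refine AlgHom.ext fun p => ?_
    obtain ⟨p, rfl⟩ := L.surjective p
    have : ((T s).comp (T (-s))).comp ((IsScalarTower.toAlgHom k _ _).comp L.toAlgHom) =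
        (IsScalarTower.toAlgHom k _ (Localization.Away f)).comp L.toAlgHom := by
      apply MvPolynomial.algHom_ext
      intro i
      change T s (T (-s) (algebraMap _ _ (L (X i)))) = algebraMap _ _ (L (X i))
      rw [hT, aeval_X, hGG s _ (hT s)]
    exact DFunLike.congr_fun this p
  refine ⟨AlgEquiv.ofAlgHom (T 1) (T (-1)) (key 1) ?_, hT 1, hT' 1, hT' (-1)⟩
  simpa using key (-1)

end Shear

section Lifting

variable {k R : Type} [Field k] [CommRing R] [Algebra k R]

theorem dvd_aeval_sub_aeval {σ : Type} {G G' : σ → R} {d : R} (h : ∀ i, d ∣ G' i - G i)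
    (p : MvPolynomial σ k) : d ∣ aeval G' p - aeval G p := by
  rw [← Ideal.mem_span_singleton, ← Ideal.Quotient.mk_eq_mk_iff_sub_mem]
  have h' : (Ideal.Quotient.mkₐ k (Ideal.span {d})) ∘ G' =
      (Ideal.Quotient.mkₐ k (Ideal.span {d})) ∘ G := by
    funext i
    exact Ideal.Quotient.mk_eq_mk_iff_sub_mem _ _ |>.2 (Ideal.mem_span_singleton.2 (h i))
  have := congr_arg (fun g => aeval (R := k) g p) h'
  exact (comp_aeval_apply (f := G') (Ideal.Quotient.mkₐ k (Ideal.span {d})) p).trans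
    (this.trans (comp_aeval_apply (f := G) (Ideal.Quotient.mkₐ k (Ideal.span {d})) p).symm)

theorem aeval_cons_X_zero_mul_add {n : ℕ} (w : R) (G : Fin n → R) (q c : MvPolynomial (Fin n) k) :
    aeval (Fin.cons w G : Fin (n + 1) → R) (X 0 * rename Fin.succ q + rename Fin.succ c) =
      w * aeval G q + aeval G c := by
  simp [aeval_rename, Function.comp_def]

/-- A change of the coordinates on which a polynomial `X₀ q + c` depends nonlinearly, which
preserves `q` and is congruent to the identity modulo `q`, can be compensated in `X₀`. -/
theorem exists_lift_of_dvd {σ : Type} {q : MvPolynomial σ k} (c : MvPolynomial σ k)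
    {G G' : σ → R} {d : R} (hdvd : ∀ i, aeval G q * d ∣ G' i - G i) (w : R) :
    ∃ w', w' * aeval G q + aeval G' c = w * aeval G q + aeval G c ∧ d ∣ w' - w := by
  obtain ⟨e, he⟩ := dvd_aeval_sub_aeval hdvd c
  refine ⟨w - d * e, ?_, -e, by ring⟩
  linear_combination he

end Lifting

section QuadricFamilies

variable {k : Type} [Field k] {n : ℕ} {f : MvPolynomial (Fin (n + 1)) k}

theorem exists_algEquiv_of_family_of_quadric (hf0 : f ≠ 0) (hf : f.IsHomogeneous 3)
    (L : MvPolynomial (Fin (n + 1)) k ≃ₐ[k] MvPolynomial (Fin (n + 1)) k)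
    {q c : MvPolynomial (Fin n) k} (hL : L (X 0 * rename Fin.succ q + rename Fin.succ c) = f)
    (hL' : ∀ i, (L.symm (X i)).IsHomogeneous 1)
    (hq : (L (rename Fin.succ q)).IsHomogeneous 2) (hc : c.IsHomogeneous 3) (hq0 : q ≠ 0)
    {H : k → Fin n → Localization.Away f} (hH : ∀ s i, H s i ∈ fractionsOfDegree hf 1)
    (hHq : ∀ s, aeval (H s) q = algebraMap _ _ (L (rename Fin.succ q)))
    (hdvd : ∀ s i, algebraMap _ _ (L (rename Fin.succ q)) ∣ H s i - algebraMap _ _ (L (X i.succ)))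
    (hHH : ∀ s (T : Localization.Away f →ₐ[k] Localization.Away f),
      T (algebraMap _ _ f) = algebraMap _ _ f →
      (∀ p, T (algebraMap _ _ (L (rename Fin.succ p))) = aeval (H s) p) →
      ∀ i, T (H (-s) i) = algebraMap _ _ (L (X i.succ))) :
    ∃ S : Localization.Away f ≃ₐ[k] Localization.Away f, S (algebraMap _ _ f) = algebraMap _ _ f ∧
      (∀ p, S (algebraMap _ _ (L (rename Fin.succ p))) = aeval (H 1) p) ∧
      (∀ u ∈ fractionsOfDegree hf 0, S u ∈ fractionsOfDegree hf 0) ∧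
      ∀ u ∈ fractionsOfDegree hf 0, S.symm u ∈ fractionsOfDegree hf 0 := by
  have hle : Submonoid.powers f ≤ nonZeroDivisors _ := powers_le_nonZeroDivisors_of_noZeroDivisors hf0
  have : IsDomain (Localization.Away f) := IsLocalization.isDomain_localization hle
  set g : Fin n → Localization.Away f := fun i => algebraMap _ _ (L (X i.succ)) with hg
  set w : Localization.Away f := algebraMap _ _ (L (X 0)) with hw
  have hgp (p : MvPolynomial (Fin n) k) : algebraMap _ _ (L (rename Fin.succ p)) = aeval g p := by
    have : ((IsScalarTower.toAlgHom k _ (Localization.Away f)).comp L.toAlgHom).comp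
        (rename Fin.succ) = aeval g := by
      apply MvPolynomial.algHom_ext
      intro i
      simp [hg]
    exact DFunLike.congr_fun this p
  have hLf : w * aeval g q + aeval g c = algebraMap _ _ f := by
    rw [← hgp, ← hgp, hw, ← map_mul, ← map_add, ← map_mul, ← map_add, hL]
  have hq0' : L (rename Fin.succ q) ≠ 0 := by
    rw [ne_eq, map_eq_zero_iff _ L.injective, map_eq_zero_iff _ (rename_injective _ (Fin.succ_injective n))]
    exact hq0
  have hgq : aeval g q ≠ 0 := by
    rw [← hgp, ne_eq, map_eq_zero_iff _ (IsLocalization.injective (Localization.Away f) hle)]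
    exact hq0'
  choose W hW _ using fun s => exists_lift_of_dvd (q := q) (R := Localization.Away f) c
    (G := g) (G' := H s) (d := 1) (fun i => by rw [mul_one, ← hgp]; exact hdvd s i) w
  have hWmem (s : k) : W s ∈ fractionsOfDegree hf 1 := by
    apply mem_fractionsOfDegree_of_mul hf0 hq hq0'
    have : algebraMap _ _ (L (rename Fin.succ q)) * W s = algebraMap _ _ f - aeval (H s) c := by
      rw [← hLf, ← hW s, hgp]; ring
    rw [this]
    exact Submodule.sub_mem _ (algebraMap_mem_fractionsOfDegree hf)
      (aeval_mem_fractionsOfDegree (hH s) hc)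
  have hWf (s : k) : W s * aeval (H s) q + aeval (H s) c = algebraMap _ _ f := by
    rw [hHq, hgp, hW, hLf]
  obtain ⟨S, hS, hS0, hS0'⟩ := exists_algEquiv_of_family hf L hL hL'
    (G := fun s => (Fin.cons (W s) (H s) : Fin (n + 1) → Localization.Away f))
    (fun s i => by
      refine Fin.cases ?_ (fun i => ?_) i
      · exact hWmem s
      · exact hH s i)
    (fun s => by rw [aeval_cons_X_zero_mul_add, hWf]) <| by
      intro s T hT
      have hTf : T (algebraMap _ _ f) = algebraMap _ _ f := by
        have h := hT (X 0 * rename Fin.succ q + rename Fin.succ c)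
        rwa [aeval_cons_X_zero_mul_add, hWf, hL] at h
      have hTp (p : MvPolynomial (Fin n) k) : T (algebraMap _ _ (L (rename Fin.succ p))) = aeval (H s) p := by
        rw [hT, aeval_rename]; rfl
      have hTH := hHH s T hTf hTp
      have hTHp (p : MvPolynomial (Fin n) k) : T (aeval (H (-s)) p) = aeval g p := by
        rw [comp_aeval_apply]
        exact congr_arg (fun g => aeval g p) (funext hTH)
      intro i
      refine Fin.cases ?_ (fun i => ?_) i
      · have h := congr_arg T (hWf (-s))
        rw [map_add, map_mul, hTHp, hTHp, hTf, ← hLf] at h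
        exact mul_right_cancel₀ hgq (add_right_cancel h)
      · exact hTH i
  refine ⟨S, ?_, fun p => ?_, hS0, hS0'⟩
  · have h := hS (X 0 * rename Fin.succ q + rename Fin.succ c)
    rwa [aeval_cons_X_zero_mul_add, hWf, hL] at h
  · rw [hS, aeval_rename]; rfl

end QuadricFamilies

/-- The complement of the cubic surface `V(f)` has an automorphism over `k` which does not extend
to an automorphism of projective space. -/
def HasNonextendingAutomorphism {k : Type} [Field k] (f : MvPolynomial (Fin (3 + 1)) k) : Prop :=
  ∃ φ : PnF k 3 f ≅ PnF k 3 f,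
    φ.hom ≫ PnFStruct k 3 f = PnFStruct k 3 f ∧
    ¬ ∃ Φ : ProjSpace k 3 ≅ ProjSpace k 3,
        Φ.hom ≫ projStruct k 3 = projStruct k 3 ∧
        (Proj.basicOpen (grading k 3) f).ι ≫ Φ.hom
          = φ.hom ≫ (Proj.basicOpen (grading k 3) f).ι

open HomogeneousLocalization in
theorem exists_automorphism_not_extending {k : Type} [Field k] {f : MvPolynomial (Fin (3 + 1)) k}
    (hf : Irreducible f) (hfd : f.IsHomogeneous 3) (S : Localization.Away f ≃ₐ[k] Localization.Away f)
    (hS : ∀ u ∈ fractionsOfDegree hfd 0, S u ∈ fractionsOfDegree hfd 0)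
    (hS' : ∀ u ∈ fractionsOfDegree hfd 0, S.symm u ∈ fractionsOfDegree hfd 0)
    {l m b : MvPolynomial (Fin (3 + 1)) k} (hl : l.IsHomogeneous 1) (hfl : ¬ f ∣ l)
    (hm : m.IsHomogeneous 1) (hb : b.IsHomogeneous 4) (hfb : ¬ f ∣ b)
    (hSf : S (algebraMap _ _ f) = algebraMap _ _ f) (hSl : S (algebraMap _ _ l) = algebraMap _ _ l)
    (hSm : S (algebraMap _ _ m) * algebraMap _ _ f = algebraMap _ _ (f * m + b)) :
    HasNonextendingAutomorphism f := by
  obtain ⟨τ, hτ⟩ := exists_away_ringEquiv (𝒜 := grading k 3) S.toRingEquiv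
    (fun a => exists_val_eq (hS _ (val_mem_fractionsOfDegree a)))
    (fun a => exists_val_eq (hS' _ (val_mem_fractionsOfDegree a)))
  have hfd' : f ∈ grading k 3 3 := hfd
  set I := Proj.basicOpenIsoSpec (grading k 3) f hfd' three_pos with hI
  let φ : PnF k 3 f ≅ PnF k 3 f :=
    { hom := I.hom ≫ Spec.map (CommRingCat.ofHom τ.toRingHom) ≫ I.inv
      inv := I.hom ≫ Spec.map (CommRingCat.ofHom τ.symm.toRingHom) ≫ I.inv
      hom_inv_id := by
        simp only [Category.assoc, Iso.inv_hom_id_assoc, ← Spec.map_comp_assoc,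
          ← CommRingCat.ofHom_comp]
        simp
      inv_hom_id := by
        simp only [Category.assoc, Iso.inv_hom_id_assoc, ← Spec.map_comp_assoc,
          ← CommRingCat.ofHom_comp]
        simp }
  have hι : (Proj.basicOpen (grading k 3) f).ι = I.hom ≫ Proj.awayι (grading k 3) f hfd' three_pos := by
    rw [Proj.awayι, Iso.hom_inv_id_assoc]
  have hl' : l ∈ grading k 3 1 := hl
  have hl3 : l ^ 3 ∈ grading k 3 (1 • 3) := hl.pow 3
  have hml : m * l ^ 2 ∈ grading k 3 (1 • 3) := hm.mul (hl.pow 2)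
  have hbl : (f * m + b) * l ^ 2 ∈ grading k 3 (2 • 3) :=
    ((hfd.mul hm).add hb).mul (hl.pow 2)
  have hu : IsUnit (algebraMap (MvPolynomial (Fin (3 + 1)) k) (Localization.Away f) f) :=
    IsLocalization.Away.algebraMap_isUnit f
  have hτmk (n : ℕ) (a : MvPolynomial (Fin (3 + 1)) k) (ha : a ∈ grading k 3 (n • 3))
      (n' : ℕ) (a' : MvPolynomial (Fin (3 + 1)) k) (ha' : a' ∈ grading k 3 (n' • 3))
      (h : S (algebraMap _ _ a) * algebraMap _ _ f ^ n' = algebraMap _ _ a' * algebraMap _ _ f ^ n) :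
      τ (Away.mk (grading k 3) hfd' n a ha) = Away.mk (grading k 3) hfd' n' a' ha' := by
    apply val_injective
    rw [hτ]
    have hval (n : ℕ) (a : MvPolynomial (Fin (3 + 1)) k) (ha : a ∈ grading k 3 (n • 3)) :
        (Away.mk (grading k 3) hfd' n a ha).val * algebraMap _ _ f ^ n = algebraMap _ _ a := by
      rw [Away.val_mk, Localization.mk_eq_mk', ← map_pow]
      exact IsLocalization.mk'_spec _ a (⟨f ^ n, n, rfl⟩ : Submonoid.powers f)
    have hval' := congr_arg S (hval n a ha)
    rw [map_mul, map_pow, hSf] at hval'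
    rw [← hval', ← hval n' a' ha'] at h
    apply (hu.pow (n + n')).mul_right_cancel
    change S _ * _ = _
    rw [pow_add]
    linear_combination h
  refine ⟨φ, ?_, ?_⟩
  · change (I.hom ≫ Spec.map (CommRingCat.ofHom τ.toRingHom) ≫ I.inv) ≫ _ ≫ _ ≫ _ = _ ≫ _ ≫ _
    rw [hι]
    simp only [Category.assoc, Iso.inv_hom_id_assoc, Proj.awayι_toSpecZero_assoc, ← Spec.map_comp,
      ← CommRingCat.ofHom_comp]
    congr 3
    ext c
    have hc : (algebraMap k (Localization.Away f) c) = (fromZeroRingHom (grading k 3) (.powers f)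
        (algebraMap k (grading k 3 0) c)).val := by
      rw [IsScalarTower.algebraMap_apply k (MvPolynomial (Fin (3 + 1)) k)]
      exact (Localization.mk_one_eq_algebraMap _).symm
    change (τ (fromZeroRingHom (grading k 3) (.powers f) (algebraMap k (grading k 3 0) c))).val =
      (fromZeroRingHom (grading k 3) (.powers f) (algebraMap k (grading k 3 0) c)).val
    rw [hτ, ← hc]
    exact S.commutes c
  · rintro ⟨Φ, -, hΦ⟩
    refine not_extends hf.prime hfd' hl' hfl hm hfb τ.toRingHom hl3 hml hbl ?_ ?_ φ.hom ?_ Φ hΦ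
    · refine hτmk _ _ _ _ _ _ ?_
      simp [hSl]
    · refine hτmk _ _ _ _ _ _ ?_
      simp only [map_mul, map_pow, hSl, map_add] at hSm ⊢
      linear_combination algebraMap _ _ f * algebraMap _ _ l ^ 2 * hSm
    · exact Iso.inv_hom_id_assoc _ _

open IsLocalization.Away in
theorem algebraMap_mul_invSelf_mem_fractionsOfDegree {k σ : Type} [Field k] {f a : MvPolynomial σ k}
    {hf : f.IsHomogeneous 3} {d : ℕ} (ha : a.IsHomogeneous (d + 3)) :
    algebraMap _ _ a * invSelf (S := Localization.Away f) f ∈ fractionsOfDegree hf d := by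
  refine ⟨1, a, ha, ?_⟩
  rw [pow_one, mul_assoc, mul_comm (invSelf f), mul_invSelf, mul_one]

open IsLocalization.Away in
theorem map_invSelf {k A : Type} [CommRing k] [CommRing A] [Algebra k A] {f : A}
    (T : Localization.Away f →ₐ[k] Localization.Away f) (hT : T (algebraMap _ _ f) = algebraMap _ _ f) :
    T (invSelf f) = invSelf f := by
  have h : algebraMap A (Localization.Away f) f * invSelf f = 1 := mul_invSelf f
  have h' := congr_arg T h
  rw [map_mul, hT, map_one] at h'
  linear_combination invSelf f * h' - T (invSelf f) * h

theorem isHomogeneous_map_algEquiv {k σ : Type} [Field k]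
    {L : MvPolynomial σ k ≃ₐ[k] MvPolynomial σ k} (hL : ∀ i, (L (X i)).IsHomogeneous 1)
    {p : MvPolynomial σ k} {d : ℕ} (hp : p.IsHomogeneous d) : (L p).IsHomogeneous d := by
  have := hp.aeval (φ := p) (fun i => L (X i)) hL
  rw [one_mul] at this
  convert! this using 1
  exact DFunLike.congr_fun (aeval_unique L.toAlgHom) p

theorem not_dvd_of_isHomogeneous_of_lt {k σ : Type} [Field k] {f p : MvPolynomial σ k} {d e : ℕ}
    (hf : f.IsHomogeneous e) (hf0 : f ≠ 0) (hp : p.IsHomogeneous d) (hp0 : p ≠ 0) (hde : d < e) :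
    ¬ f ∣ p := by
  rintro ⟨g, rfl⟩
  have hg0 : g ≠ 0 := right_ne_zero_of_mul hp0
  have h := totalDegree_mul_of_isDomain hf0 hg0
  rw [hp.totalDegree hp0, hf.totalDegree hf0] at h
  omega

theorem finSuccEquiv_rename_succ {R : Type} [CommSemiring R] {n : ℕ} (p : MvPolynomial (Fin n) R) :
    finSuccEquiv R n (rename Fin.succ p) = Polynomial.C p := by
  induction p using MvPolynomial.induction_on with
  | C a => simp [finSuccEquiv_apply]
  | add p q hp hq => rw [map_add, map_add, hp, hq, map_add]
  | mul_X p i hp => rw [map_mul, map_mul, hp, rename_X, finSuccEquiv_X_succ, map_mul]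

section NormalForms

variable {k : Type} [Field k] {f : MvPolynomial (Fin (3 + 1)) k}
  {L : MvPolynomial (Fin (3 + 1)) k ≃ₐ[k] MvPolynomial (Fin (3 + 1)) k}

open IsLocalization.Away in
/-- The case of a cone over a plane cubic curve. -/
theorem HasNonextendingAutomorphism.of_cone (hf : Irreducible f) (hfd : f.IsHomogeneous 3)
    (hLX : ∀ i, (L (X i)).IsHomogeneous 1) (hL' : ∀ i, (L.symm (X i)).IsHomogeneous 1)
    {c : MvPolynomial (Fin 3) k} (hL : L (rename Fin.succ c) = f) :
    HasNonextendingAutomorphism f := by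
  set g : Fin 3 → Localization.Away f := fun i => algebraMap _ _ (L (X i.succ)) with hg
  set G : k → Fin (3 + 1) → Localization.Away f := fun s => Fin.cons
    (algebraMap _ _ (L (X 0)) + s • (algebraMap _ _ (L (X 1) ^ 4) * invSelf f)) g with hG
  have hgc : aeval g c = algebraMap _ _ f := by
    have : ((IsScalarTower.toAlgHom k _ (Localization.Away f)).comp L.toAlgHom).comp
        (rename Fin.succ) = aeval g := by
      apply MvPolynomial.algHom_ext
      intro i
      simp [hg]
    rw [← this]
    exact congr_arg (algebraMap _ _) hL
  have hGf (s : k) : aeval (G s) (rename Fin.succ c) = algebraMap _ _ f := by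
    rw [aeval_rename, ← hgc]; rfl
  obtain ⟨S, hS, hS0, hS0'⟩ := exists_algEquiv_of_family hfd L hL hL' (G := G)
    (fun s i => by
      refine Fin.cases ?_ (fun i => ?_) i
      · exact Submodule.add_mem _ (algebraMap_mem_fractionsOfDegree (hLX 0)) (Submodule.smul_mem _ _
          (algebraMap_mul_invSelf_mem_fractionsOfDegree ((hLX 1).pow 4)))
      · exact algebraMap_mem_fractionsOfDegree (hLX _)) hGf <| by
    intro s T hT i
    refine Fin.cases ?_ (fun i => ?_) i
    · have hTf : T (algebraMap _ _ f) = algebraMap _ _ f := by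
        have h := hT (rename Fin.succ c)
        rwa [hGf, hL] at h
      have h1 : T (algebraMap _ _ (L (X 1))) = algebraMap _ _ (L (X 1)) := by
        rw [hT, aeval_X]; rfl
      simp only [hG, Fin.cons_zero, map_add, map_smul, map_mul, map_pow, h1, map_invSelf T hTf,
        hT (X 0), aeval_X, neg_smul, map_neg]
      ring
    · change T (algebraMap _ _ (L (X i.succ))) = _
      rw [hT, aeval_X]; rfl
  have hfX : ¬ f ∣ L (X 1) := not_dvd_of_isHomogeneous_of_lt hfd hf.ne_zero (hLX 1)
    ((map_ne_zero_iff L L.injective).2 (X_ne_zero 1)) (by norm_num)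
  refine exists_automorphism_not_extending hf hfd S hS0 hS0' (hLX 1) hfX (hLX 0)
    ((hLX 1).pow 4) (fun h => hfX (hf.prime.dvd_of_dvd_pow h)) ?_ ?_ ?_
  · have h := hS (rename Fin.succ c)
    rwa [hGf, hL] at h
  · rw [hS, aeval_X]; rfl
  · have hu : algebraMap _ (Localization.Away f) f * invSelf f = 1 := mul_invSelf f
    rw [hS, aeval_X]
    simp only [hG, Fin.cons_zero, one_smul, map_add, map_mul, map_pow]
    linear_combination algebraMap _ _ (L (X 1)) ^ 4 * hu

open IsLocalization.Away in
/-- The case of a quadric part independent of `X₁`. -/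
theorem HasNonextendingAutomorphism.of_quadric_cone (hf : Irreducible f) (hfd : f.IsHomogeneous 3)
    (hLX : ∀ i, (L (X i)).IsHomogeneous 1) (hL' : ∀ i, (L.symm (X i)).IsHomogeneous 1)
    {r : MvPolynomial (Fin 2) k} {c : MvPolynomial (Fin 3) k} (hr : r.IsHomogeneous 2) (hr0 : r ≠ 0)
    (hc : c.IsHomogeneous 3)
    (hL : L (X 0 * rename Fin.succ (rename Fin.succ r) + rename Fin.succ c) = f) :
    HasNonextendingAutomorphism f := by
  set q : MvPolynomial (Fin 3) k := rename Fin.succ r with hq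
  set Q := L (rename Fin.succ q) with hQ
  have hQd : Q.IsHomogeneous 2 :=
    isHomogeneous_map_algEquiv hLX (hr.rename_isHomogeneous.rename_isHomogeneous)
  have hq0 : q ≠ 0 := (map_ne_zero_iff _ (rename_injective _ (Fin.succ_injective 2))).2 hr0
  have hQ0 : Q ≠ 0 := (map_ne_zero_iff L L.injective).2
    ((map_ne_zero_iff _ (rename_injective _ (Fin.succ_injective 3))).2 hq0)
  set g : Fin 2 → Localization.Away f := fun i => algebraMap _ _ (L (X i.succ.succ)) with hg
  set H : k → Fin 3 → Localization.Away f := fun s => Fin.cons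
    (algebraMap _ _ (L (X 1)) + s • (algebraMap _ _ (L (X 2) ^ 2 * Q) * invSelf f)) g with hH
  have hgr : aeval g r = algebraMap _ _ Q := by
    have : ((IsScalarTower.toAlgHom k _ (Localization.Away f)).comp L.toAlgHom).comp
        ((rename Fin.succ).comp (rename Fin.succ)) = aeval g := by
      apply MvPolynomial.algHom_ext
      intro i
      simp [hg]
    rw [← this]
    rfl
  have hHq (s : k) : aeval (H s) q = algebraMap _ _ Q := by
    rw [hq, aeval_rename, ← hgr]; rfl
  obtain ⟨S, hSf, hS, hS0, hS0'⟩ := exists_algEquiv_of_family_of_quadric hf.ne_zero hfd L hL hL'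
    hQd hc hq0 (H := H)
    (fun s i => by
      refine Fin.cases ?_ (fun i => ?_) i
      · exact Submodule.add_mem _ (algebraMap_mem_fractionsOfDegree (hLX 1)) (Submodule.smul_mem _ _
          (algebraMap_mul_invSelf_mem_fractionsOfDegree (((hLX 2).pow 2).mul hQd)))
      · exact algebraMap_mem_fractionsOfDegree (hLX _)) hHq
    (fun s i => by
      refine Fin.cases ?_ (fun i => ?_) i
      · refine ⟨s • (algebraMap _ _ (L (X 2) ^ 2) * invSelf f), ?_⟩
        simp only [hH, Fin.cons_zero, map_mul, Algebra.smul_def, Fin.succ_zero_eq_one]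
        ring
      · exact ⟨0, by simp [hH, hg]⟩) <| by
    intro s T hTf hT
    have hTX (i : Fin 3) : T (algebraMap _ _ (L (X i.succ))) = H s i := by
      have := hT (X i)
      rwa [rename_X, aeval_X] at this
    intro i
    refine Fin.cases ?_ (fun i => ?_) i
    · have h1 : T (algebraMap _ _ (L (X 2))) = algebraMap _ _ (L (X 2)) := hTX 1
      have h2 : T (algebraMap _ _ Q) = algebraMap _ _ Q := (hT q).trans (hHq s)
      have h3 : T (algebraMap _ _ (L (X 1))) = H s 0 := hTX 0
      simp only [hH, Fin.cons_zero, map_add, map_smul, map_mul, map_pow, h1, h2, h3,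
        map_invSelf T hTf, neg_smul, map_neg, Fin.succ_zero_eq_one]
      ring
    · exact hTX i.succ
  have hSX (i : Fin 3) : S (algebraMap _ _ (L (X i.succ))) = H 1 i := by
    have := hS (X i)
    rwa [rename_X, aeval_X] at this
  have hfX : ¬ f ∣ L (X 2) := not_dvd_of_isHomogeneous_of_lt hfd hf.ne_zero (hLX 2)
    ((map_ne_zero_iff L L.injective).2 (X_ne_zero 2)) (by norm_num)
  have hfQ : ¬ f ∣ Q := not_dvd_of_isHomogeneous_of_lt hfd hf.ne_zero hQd hQ0 (by norm_num)
  refine exists_automorphism_not_extending hf hfd S hS0 hS0' (hLX 2) hfX (hLX 1)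
    (((hLX 2).pow 2).mul hQd) (fun h => (hf.prime.dvd_or_dvd h).elim
      (fun h => hfX (hf.prime.dvd_of_dvd_pow h)) hfQ) hSf (hSX 1) ?_
  have hu : algebraMap _ (Localization.Away f) f * invSelf f = 1 := mul_invSelf f
  rw [show S (algebraMap _ _ (L (X 1))) = H 1 0 from hSX 0]
  simp only [hH, Fin.cons_zero, one_smul, map_add, map_mul, map_pow]
  linear_combination algebraMap _ _ (L (X 2)) ^ 2 * algebraMap _ _ Q * hu

open IsLocalization.Away in
/-- The case of a quadric part that is a nontrivial linear polynomial in `X₁`. -/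
theorem HasNonextendingAutomorphism.of_quadric (hf : Irreducible f) (hfd : f.IsHomogeneous 3)
    (hLX : ∀ i, (L (X i)).IsHomogeneous 1) (hL' : ∀ i, (L.symm (X i)).IsHomogeneous 1)
    {α β : k} (hαβ : α ≠ 0 ∨ β ≠ 0) {r : MvPolynomial (Fin 2) k} {c : MvPolynomial (Fin 3) k}
    (hr : r.IsHomogeneous 2) (hc : c.IsHomogeneous 3)
    (hL : L (X 0 * rename Fin.succ (X 0 * rename Fin.succ (C α * X 0 + C β * X 1) +
      rename Fin.succ r) + rename Fin.succ c) = f) :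
    HasNonextendingAutomorphism f := by
  set l : MvPolynomial (Fin 2) k := C α * X 0 + C β * X 1 with hl
  set q : MvPolynomial (Fin 3) k := X 0 * rename Fin.succ l + rename Fin.succ r with hq
  set M := L (rename Fin.succ (rename Fin.succ l)) with hM
  set Q := L (rename Fin.succ q) with hQ
  have hsucc {n : ℕ} {p : MvPolynomial (Fin n) k} : rename Fin.succ p = 0 ↔ p = 0 :=
    map_eq_zero_iff _ (rename_injective _ (Fin.succ_injective n))
  have hld : l.IsHomogeneous 1 := (isHomogeneous_C_mul_X α 0).add (isHomogeneous_C_mul_X β 1)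
  have hqd : q.IsHomogeneous 2 :=
    ((isHomogeneous_X k 0).mul hld.rename_isHomogeneous).add hr.rename_isHomogeneous
  have hl0 : l ≠ 0 := by
    intro h
    have h0 := congr_arg (eval ![1, 0]) h
    have h1 := congr_arg (eval ![0, 1]) h
    simp [hl] at h0 h1
    tauto
  have hq0 : q ≠ 0 := by
    intro h
    have h' := congr_arg (fun p => (finSuccEquiv k 2 p).coeff 1) h
    simp only [hq, map_add, map_mul, finSuccEquiv_X_zero, finSuccEquiv_rename_succ,
      Polynomial.coeff_add, Polynomial.coeff_X_mul, map_zero, Polynomial.coeff_zero,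
      Polynomial.coeff_C_zero, Polynomial.coeff_C_succ, add_zero] at h'
    exact hl0 h'
  have hMd : M.IsHomogeneous 1 :=
    isHomogeneous_map_algEquiv hLX (hld.rename_isHomogeneous.rename_isHomogeneous)
  have hM0 : M ≠ 0 := (map_ne_zero_iff L L.injective).2 (by rwa [ne_eq, hsucc, hsucc])
  have hQd : Q.IsHomogeneous 2 := isHomogeneous_map_algEquiv hLX hqd.rename_isHomogeneous
  have hQ0 : Q ≠ 0 := (map_ne_zero_iff L L.injective).2 (by rwa [ne_eq, hsucc])
  set ι := algebraMap (MvPolynomial (Fin (3 + 1)) k) (Localization.Away f) with hι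
  set z := ι (L (X 1)) with hz
  set g : Fin 2 → Localization.Away f := ![ι (L (X 2)), ι (L (X 3))] with hg
  set V : k → Fin 2 → Localization.Away f := fun s =>
    ![ι (L (X 2)) + (s * β) • (ι (M ^ 2 * Q) * invSelf f),
      ι (L (X 3)) - (s * α) • (ι (M ^ 2 * Q) * invSelf f)] with hV
  have hgp (p : MvPolynomial (Fin 2) k) : ι (L (rename Fin.succ (rename Fin.succ p))) = aeval g p := by
    have : ((IsScalarTower.toAlgHom k _ (Localization.Away f)).comp L.toAlgHom).comp
        ((rename Fin.succ).comp (rename Fin.succ)) = aeval g := by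
      apply MvPolynomial.algHom_ext
      intro i
      fin_cases i <;> simp [hg, hι]
    rw [← this]
    rfl
  have hgQ : z * aeval g l + aeval g r = ι Q := by
    rw [← hgp, ← hgp, hz, ← map_mul, ← map_mul, ← map_add, ← map_add, hQ, hq]
    simp
  have hVl (s : k) : aeval (V s) l = ι M := by
    rw [hM, hgp, hl]
    simp only [hV, hg, map_add, map_mul, aeval_C, aeval_X, Matrix.cons_val_zero, Matrix.cons_val_one,
      Matrix.cons_val_fin_one, Algebra.smul_def]
    ring
  choose Z hZ hZd using fun s => exists_lift_of_dvd (q := l) (R := Localization.Away f) r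
    (G := g) (G' := V s) (d := ι (M * Q) * invSelf f) (fun i => by
      rw [← hgp, ← hM]
      fin_cases i
      · refine ⟨(s * β) • 1, ?_⟩
        simp only [hV, hg, map_mul, map_pow, Algebra.smul_def, Fin.zero_eta, Matrix.cons_val_zero]
        ring
      · refine ⟨-((s * α) • 1), ?_⟩
        simp only [hV, hg, map_mul, map_pow, Algebra.smul_def, Fin.mk_one, Matrix.cons_val_one, Matrix.cons_val_fin_one]
        ring) z
  have hVmem (s : k) (i : Fin 2) : V s i ∈ fractionsOfDegree hfd 1 := by
    have h (a : k) : a • (ι (M ^ 2 * Q) * invSelf f) ∈ fractionsOfDegree hfd 1 :=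
      Submodule.smul_mem _ _ (algebraMap_mul_invSelf_mem_fractionsOfDegree ((hMd.pow 2).mul hQd))
    fin_cases i
    · exact Submodule.add_mem _ (algebraMap_mem_fractionsOfDegree (hLX 2)) (h _)
    · exact Submodule.sub_mem _ (algebraMap_mem_fractionsOfDegree (hLX 3)) (h _)
  have hZQ (s : k) : Z s * aeval (V s) l + aeval (V s) r = ι Q := by
    rw [hVl, hM, hgp, hZ, hgQ]
  have hZmem (s : k) : Z s ∈ fractionsOfDegree hfd 1 := by
    apply mem_fractionsOfDegree_of_mul hf.ne_zero hMd hM0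
    have : ι M * Z s = ι Q - aeval (V s) r := by
      rw [← hZQ s, hVl]; ring
    rw [← hι, this]
    exact Submodule.sub_mem _ (algebraMap_mem_fractionsOfDegree hQd)
      (aeval_mem_fractionsOfDegree (hVmem s) hr)
  have hdom : IsDomain (Localization.Away f) := IsLocalization.isDomain_localization
    (powers_le_nonZeroDivisors_of_noZeroDivisors hf.ne_zero)
  have hιM : ι M ≠ 0 := (map_ne_zero_iff ι (IsLocalization.injective (Localization.Away f)
    (powers_le_nonZeroDivisors_of_noZeroDivisors hf.ne_zero))).2 hM0
  obtain ⟨S, hSf, hS, hS0, hS0'⟩ := exists_algEquiv_of_family_of_quadric hf.ne_zero hfd L hL hL'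
    hQd hc hq0 (H := fun s => (Fin.cons (Z s) (V s) : Fin 3 → Localization.Away f))
    (fun s i => by
      refine Fin.cases ?_ (fun i => ?_) i
      · exact hZmem s
      · exact hVmem s i)
    (fun s => by rw [hq, aeval_cons_X_zero_mul_add, hZQ])
    (fun s i => by
      rw [← hι, ← hQ]
      refine Fin.cases ?_ (fun i => ?_) i
      · refine Dvd.dvd.trans ⟨ι M * invSelf f, ?_⟩ (hZd s)
        rw [map_mul]; ring
      · fin_cases i
        · refine ⟨(s * β) • (ι (M ^ 2) * invSelf f), ?_⟩
          change V s 0 - ι (L (X 2)) = _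
          simp only [hV, map_mul, map_pow, Algebra.smul_def, Matrix.cons_val_zero]
          ring
        · refine ⟨-((s * α) • (ι (M ^ 2) * invSelf f)), ?_⟩
          change V s 1 - ι (L (X 3)) = _
          simp only [hV, map_mul, map_pow, Algebra.smul_def, Matrix.cons_val_one, Matrix.cons_val_fin_one]
          ring) <| by
    intro s T hTf hT
    have hTX (i : Fin 2) : T (g i) = V s i := by
      have := hT (X i.succ)
      rw [rename_X, aeval_X] at this
      fin_cases i <;> exact this
    have hTM : T (ι M) = ι M := by
      rw [hM, hT, aeval_rename, ← hM, ← hVl s]; rfl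
    have hTQ : T (ι Q) = ι Q := by
      rw [hQ, hT, hq, aeval_cons_X_zero_mul_add, hZQ]
    have hTV (i : Fin 2) : T (V (-s) i) = g i := by
      have h0 : T (ι (L (X 2))) = V s 0 := hTX 0
      have h1 : T (ι (L (X 3))) = V s 1 := hTX 1
      fin_cases i
      · simp only [hV, hg, map_add, map_smul, map_mul, map_pow, hTM, hTQ, h0, map_neg, Fin.zero_eta,
          map_invSelf T hTf, neg_mul, neg_smul, Matrix.cons_val_zero]
        ring
      · simp only [hV, hg, map_sub, map_smul, map_mul, map_pow, hTM, hTQ, h1, map_neg, Fin.mk_one,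
          map_invSelf T hTf, neg_mul, neg_smul, Matrix.cons_val_one, Matrix.cons_val_fin_one]
        ring
    have hTVp (p : MvPolynomial (Fin 2) k) : T (aeval (V (-s)) p) = aeval g p := by
      rw [comp_aeval_apply]
      exact congr_arg (fun g => aeval g p) (funext hTV)
    intro i
    refine Fin.cases ?_ (fun i => ?_) i
    · have h := congr_arg T (hZQ (-s))
      rw [map_add, map_mul, hTVp, hTVp, hTQ, ← hgQ, ← hgp l, ← hM] at h
      exact mul_right_cancel₀ hιM (add_right_cancel h)
    · refine (hTV i).trans ?_
      fin_cases i <;> rfl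
  have hSX (i : Fin 3) : S (ι (L (X i.succ))) = (Fin.cons (Z 1) (V 1) : Fin 3 → _) i := by
    have := hS (X i)
    rwa [rename_X, aeval_X] at this
  have hSM : S (ι M) = ι M := by
    rw [hM, hS, aeval_rename, ← hM, ← hVl 1]; rfl
  have hfM : ¬ f ∣ M := not_dvd_of_isHomogeneous_of_lt hfd hf.ne_zero hMd hM0 (by norm_num)
  have hfQ : ¬ f ∣ Q := not_dvd_of_isHomogeneous_of_lt hfd hf.ne_zero hQd hQ0 (by norm_num)
  have hb {a : k} (ha : a ≠ 0) : ¬ f ∣ C a * (M ^ 2 * Q) := by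
    intro h
    rw [((isUnit_iff_ne_zero.2 ha).map C).dvd_mul_left] at h
    exact (hf.prime.dvd_or_dvd h).elim (fun h => hfM (hf.prime.dvd_of_dvd_pow h)) hfQ
  have hbd (a : k) : (C a * (M ^ 2 * Q)).IsHomogeneous 4 := ((hMd.pow 2).mul hQd).C_mul a
  have hu : ι f * invSelf f = 1 := mul_invSelf f
  have hC (a : k) : algebraMap k (Localization.Away f) a = ι (C a) :=
    IsScalarTower.algebraMap_apply k (MvPolynomial (Fin (3 + 1)) k) _ a
  rcases hαβ with hα | hβ
  · refine exists_automorphism_not_extending hf hfd S hS0 hS0' hMd hfM (hLX 3)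
      (hbd (-α)) (hb (neg_ne_zero.2 hα)) hSf hSM ?_
    rw [show S (algebraMap _ _ (L (X 3))) = V 1 1 from hSX 2]
    simp only [hV, Matrix.cons_val_one, Matrix.cons_val_fin_one, map_add, map_mul, map_pow, one_mul,
      Algebra.smul_def, hC, map_one, ← hι, map_neg]
    linear_combination -ι (C α) * ι M ^ 2 * ι Q * hu
  · refine exists_automorphism_not_extending hf hfd S hS0 hS0' hMd hfM (hLX 2)
      (hbd β) (hb hβ) hSf hSM ?_
    rw [show S (algebraMap _ _ (L (X 2))) = V 1 0 from hSX 1]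
    simp only [hV, Matrix.cons_val_zero, map_add, map_mul, map_pow, one_mul, Algebra.smul_def, hC,
      map_one, ← hι]
    linear_combination ι (C β) * ι M ^ 2 * ι Q * hu

end NormalForms

section Coordinates

theorem degree_eq_of_coeff_ne_zero {σ R : Type} [CommSemiring R] {p : MvPolynomial σ R} {d : ℕ}
    (hp : p.IsHomogeneous d) {m : σ →₀ ℕ} (hm : coeff m p ≠ 0) : m.degree = d := by
  rw [Finsupp.degree_eq_weight_one]
  exact hp hm

theorem eval_smul_of_isHomogeneous {σ R : Type} [CommSemiring R] {p : MvPolynomial σ R} {d : ℕ}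
    (hp : p.IsHomogeneous d) (t : R) (v : σ → R) : eval (t • v) p = t ^ d * eval v p := by
  rw [eval_eq, eval_eq, Finset.mul_sum]
  refine Finset.sum_congr rfl fun m hm => ?_
  have hm' : ∑ i ∈ m.support, m i = d := by
    rw [← Finsupp.degree_apply, degree_eq_of_coeff_ne_zero hp (mem_support_iff.mp hm)]
  simp only [Pi.smul_apply, smul_eq_mul, mul_pow, Finset.prod_mul_distrib]
  rw [Finset.prod_pow_eq_pow_sum, hm']
  ring

theorem exists_eval_line_eq_zero {σ k : Type} [Field k] [IsAlgClosed k] {p : MvPolynomial σ k}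
    {d : ℕ} (hp : p.IsHomogeneous d) (hd : d ≠ 0) (a b : σ → k) :
    ∃ s t : k, (s ≠ 0 ∨ t ≠ 0) ∧ eval (s • a + t • b) p = 0 := by
  let P : Polynomial k := aeval (fun i => Polynomial.C (a i) * Polynomial.X + Polynomial.C (b i)) p
  let Q : Polynomial k := aeval (fun i => Polynomial.C (a i) + Polynomial.C (b i) * Polynomial.X) p
  have hP (t : k) : P.eval t = eval (t • a + b) p := by
    change Polynomial.evalRingHom t (aeval _ p) = _
    rw [aeval_def, MvPolynomial.hom_eval₂, ← eval₂_id]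
    congr 1
    · ext x
      exact Polynomial.eval_C
    · funext i
      simp only [Polynomial.coe_evalRingHom, Polynomial.eval_add, Polynomial.eval_mul,
        Polynomial.eval_C, Polynomial.eval_X, Pi.add_apply, Pi.smul_apply, smul_eq_mul]
      ring
  have hQ (t : k) : Q.eval t = eval (a + t • b) p := by
    change Polynomial.evalRingHom t (aeval _ p) = _
    rw [aeval_def, MvPolynomial.hom_eval₂, ← eval₂_id]
    congr 1
    · ext x
      exact Polynomial.eval_C
    · funext i
      simp only [Polynomial.coe_evalRingHom, Polynomial.eval_add, Polynomial.eval_mul,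
        Polynomial.eval_C, Polynomial.eval_X, Pi.add_apply, Pi.smul_apply, smul_eq_mul]
      ring
  by_cases hP0 : P.degree = 0
  · refine ⟨1, 0, Or.inl one_ne_zero, ?_⟩
    rw [Polynomial.eq_C_of_degree_eq_zero hP0] at hP
    simp only [Polynomial.eval_C] at hP
    have hX : Polynomial.X * (Q - Polynomial.C (P.coeff 0) * Polynomial.X ^ d) = 0 := by
      refine Polynomial.funext fun t => ?_
      rcases eq_or_ne t 0 with rfl | ht
      · simp
      have : a + t • b = t • (t⁻¹ • a + b) := by
        rw [smul_add, smul_smul, mul_inv_cancel₀ ht, one_smul]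
      simp only [Polynomial.eval_mul, Polynomial.eval_X, Polynomial.eval_sub, Polynomial.eval_C,
        Polynomial.eval_pow, Polynomial.eval_zero]
      rw [hQ, this, eval_smul_of_isHomogeneous hp, ← hP]
      ring
    have hQX := (mul_eq_zero.mp hX).resolve_left Polynomial.X_ne_zero
    have := hQ 0
    rw [sub_eq_zero.mp hQX] at this
    simpa [hd] using this.symm
  · obtain ⟨t, ht⟩ := IsAlgClosed.exists_root P hP0
    refine ⟨t, 1, Or.inr one_ne_zero, ?_⟩
    rw [one_smul, ← hP]
    exact ht

theorem eval_bind₁_toMvPolynomial {n R : Type} [Fintype n] [CommRing R] (M : Matrix n n R)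
    (p : MvPolynomial n R) (x : n → R) :
    eval x (bind₁ M.toMvPolynomial p) = eval (M.mulVec x) p := by
  rw [MvPolynomial.eval, eval₂Hom_bind₁]
  congr 2
  funext i
  exact M.toMvPolynomial_eval_eq_apply i x

theorem eval_pderiv_bind₁_toMvPolynomial {n R : Type} [Fintype n] [CommRing R] (M : Matrix n n R)
    (p : MvPolynomial n R) (j : n) (x : n → R) :
    eval x (pderiv j (bind₁ M.toMvPolynomial p)) =
      ∑ i, M i j * eval (M.mulVec x) (pderiv i p) := by
  classical
  induction p using MvPolynomial.induction_on with
  | C a => simp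
  | add p q hp hq => simp only [map_add, hp, hq, mul_add, Finset.sum_add_distrib]
  | mul_X p i hp =>
    have hM : eval x (pderiv j (M.toMvPolynomial i)) = M i j := by
      simp [Matrix.toMvPolynomial, ← C_mul_X_eq_monomial, pderiv_X, Pi.single_apply, apply_ite]
    simp only [map_mul, Derivation.leibniz, smul_eq_mul, bind₁_X_right, map_add, hp, eval_bind₁_toMvPolynomial, hM,
      pderiv_X, eval_X, mul_add, Finset.sum_add_distrib, Finset.mul_sum,
      Matrix.toMvPolynomial_eval_eq_apply]
    congr 1
    · rw [Finset.sum_eq_single i]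
      · simp [mul_comm]
      · intro l _ hl
        simp [hl.symm]
      · simp
    · exact Finset.sum_congr rfl fun l _ => by ring

theorem eval_single_of_isHomogeneous {σ R : Type} [DecidableEq σ] [CommSemiring R]
    {p : MvPolynomial σ R} {d : ℕ} (hp : p.IsHomogeneous d) (i : σ) :
    eval (Pi.single i 1) p = coeff (Finsupp.single i d) p := by
  rw [eval_eq, Finset.sum_eq_single (Finsupp.single i d)]
  · rcases eq_or_ne d 0 with rfl | hd
    · simp
    · simp [Finsupp.support_single, hd]
  · intro m hm hne
    have hm' : m.degree = d := degree_eq_of_coeff_ne_zero hp (mem_support_iff.mp hm)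
    have : ∃ j ∈ m.support, j ≠ i := by
      by_contra! h
      apply hne
      have hs := Finsupp.support_subset_singleton.mp (fun j hj => Finset.mem_singleton.mpr (h j hj))
      rw [hs, Finsupp.degree_single] at hm'
      rw [hs, hm']
    obtain ⟨j, hj, hji⟩ := this
    rw [Finset.prod_eq_zero hj, mul_zero]
    rw [Pi.single_eq_of_ne hji, zero_pow (Finsupp.mem_support_iff.mp hj)]
  · intro h
    rw [notMem_support_iff.mp h, zero_mul]

theorem exists_eq_X_zero_mul_add {n d : ℕ} {k : Type} [Field k] {p : MvPolynomial (Fin (n + 1)) k}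
    (hp : p.IsHomogeneous (d + 1)) (h : ∀ m : Fin (n + 1) →₀ ℕ, 2 ≤ m 0 → coeff m p = 0) :
    ∃ q c : MvPolynomial (Fin n) k, q.IsHomogeneous d ∧ c.IsHomogeneous (d + 1) ∧
      (∀ m, coeff m q = coeff (m.cons 1) p) ∧
      p = X 0 * rename Fin.succ q + rename Fin.succ c := by
  refine ⟨(finSuccEquiv k n p).coeff 1, (finSuccEquiv k n p).coeff 0,
    hp.finSuccEquiv_coeff_isHomogeneous 1 d (add_comm _ _),
    hp.finSuccEquiv_coeff_isHomogeneous 0 (d + 1) (zero_add _),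
    fun m => finSuccEquiv_coeff_coeff m p 1, ?_⟩
  apply (finSuccEquiv k n).injective
  rw [map_add, map_mul, finSuccEquiv_X_zero, finSuccEquiv_rename_succ, finSuccEquiv_rename_succ]
  ext i m
  rcases i with _ | _ | i
  · simp
  · simp
  · simp only [finSuccEquiv_coeff_coeff]
    rw [h _ (by simp)]
    simp [mul_comm Polynomial.X]

theorem exists_linearIndependent_pair_eval_eq_zero {k : Type} [Field k] [IsAlgClosed k] {n : ℕ}
    {g : MvPolynomial (Fin (n + 3)) k} {d : ℕ} (hg : g.IsHomogeneous d) (hd : d ≠ 0)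
    {v : Fin (n + 3) → k} (hv : v ≠ 0) :
    ∃ u, LinearIndependent k ![v, u] ∧ eval u g = 0 := by
  obtain ⟨i, hi⟩ := Function.ne_iff.mp hv
  obtain ⟨s, t, hst, h⟩ := exists_eval_line_eq_zero hg hd (Pi.single (i + 1) 1) (Pi.single (i + 2) 1)
  have h1 : i + 1 ≠ i := by simp
  have h2 : i + 2 ≠ i := by
    rw [Ne, add_eq_left]
    refine Fin.ne_of_val_ne ?_
    simp [Nat.mod_eq_of_lt]
  have h12 : i + 1 ≠ i + 2 := by
    rw [Ne, add_right_inj]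
    refine Fin.ne_of_val_ne ?_
    simp [Nat.mod_eq_of_lt]
  refine ⟨_, ?_, h⟩
  rw [LinearIndependent.pair_iff]
  intro a b hab
  have ha : a = 0 := by
    have := congr_fun hab i
    simp only [Pi.add_apply, Pi.smul_apply, Pi.single_apply, h1.symm, h2.symm, smul_eq_mul,
      if_false, mul_zero, add_zero, Pi.zero_apply, mul_eq_zero] at this
    exact this.resolve_right hi
  refine ⟨ha, ?_⟩
  have hs := congr_fun hab (i + 1)
  have ht := congr_fun hab (i + 2)
  simp only [ha, Pi.add_apply, Pi.smul_apply, Pi.single_apply, h12, h12.symm, smul_eq_mul,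
    if_true, if_false, mul_one, mul_zero, zero_mul, add_zero, zero_add, Pi.zero_apply,
    mul_eq_zero] at hs ht
  tauto

theorem exists_isUnit_matrix_mulVec {k : Type} [Field k] {v u : Fin 4 → k}
    (h : LinearIndependent k ![v, u]) :
    ∃ M : Matrix (Fin 4) (Fin 4) k, IsUnit M ∧ (∀ i, M i 0 = v i) ∧ ∀ i, M i 1 = u i := by
  obtain ⟨x, hx⟩ := exists_linearIndependent_snoc_of_lt_finrank h (by simp)
  obtain ⟨y, hy⟩ := exists_linearIndependent_snoc_of_lt_finrank hx (by simp)
  exact ⟨Matrix.of fun i j => (Fin.snoc (Fin.snoc ![v, u] x) y : Fin 4 → Fin 4 → k) j i,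
    Matrix.linearIndependent_cols_iff_isUnit.mp hy, fun _ => rfl, fun _ => rfl⟩

theorem exists_algEquiv_symm_eq_bind₁ {k σ : Type} [Field k] [Fintype σ] [DecidableEq σ]
    {M : Matrix σ σ k} (hM : IsUnit M) :
    ∃ L : MvPolynomial σ k ≃ₐ[k] MvPolynomial σ k,
      (∀ i, (L (X i)).IsHomogeneous 1) ∧ (∀ i, (L.symm (X i)).IsHomogeneous 1) ∧
      ∀ p, L.symm p = bind₁ M.toMvPolynomial p := by
  obtain ⟨M, rfl⟩ := hM
  have h {A B : Matrix σ σ k} (hAB : A * B = 1) :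
      (bind₁ B.toMvPolynomial).comp (bind₁ A.toMvPolynomial) = AlgHom.id k _ := by
    ext1 i
    rw [AlgHom.comp_apply, bind₁_X_right, ← Matrix.toMvPolynomial_mul, hAB,
      Matrix.toMvPolynomial_one, AlgHom.id_apply]
  refine ⟨AlgEquiv.ofAlgHom (bind₁ (M⁻¹ : (Matrix σ σ k)ˣ).val.toMvPolynomial)
    (bind₁ M.val.toMvPolynomial) (h M.mul_inv) (h M.inv_mul), fun i => ?_, fun i => ?_,
    fun p => rfl⟩
  · rw [AlgEquiv.ofAlgHom_apply, bind₁_X_right]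
    exact Matrix.toMvPolynomial_isHomogeneous _ _
  · rw [AlgEquiv.ofAlgHom_symm, AlgEquiv.ofAlgHom_apply, bind₁_X_right]
    exact Matrix.toMvPolynomial_isHomogeneous _ _

theorem exists_eq_of_isHomogeneous_one {k : Type} [Field k] {p : MvPolynomial (Fin 2) k}
    (hp : p.IsHomogeneous 1) : ∃ α β : k, p = C α * X 0 + C β * X 1 := by
  have h : p ∈ homogeneousSubmodule (Fin 2) k 1 := hp
  rw [homogeneousSubmodule_one_eq_span_X, Submodule.mem_span_range_iff_exists_fun] at h
  obtain ⟨c, hc⟩ := h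
  refine ⟨c 0, c 1, ?_⟩
  rw [← hc, Fin.sum_univ_two, smul_eq_C_mul, smul_eq_C_mul]

theorem exists_normal_form {k : Type} [Field k] [IsAlgClosed k] {f : MvPolynomial (Fin (3 + 1)) k}
    (hfd : f.IsHomogeneous 3) {v : Fin (3 + 1) → k} (hv : v ≠ 0) (hvf : eval v f = 0)
    (hv' : ∀ i, eval v (pderiv i f) = 0) :
    ∃ L : MvPolynomial (Fin (3 + 1)) k ≃ₐ[k] MvPolynomial (Fin (3 + 1)) k,
      (∀ i, (L (X i)).IsHomogeneous 1) ∧ (∀ i, (L.symm (X i)).IsHomogeneous 1) ∧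
      ∃ (α β : k) (r : MvPolynomial (Fin 2) k) (c : MvPolynomial (Fin 3) k),
        r.IsHomogeneous 2 ∧ c.IsHomogeneous 3 ∧
        L (X 0 * rename Fin.succ (X 0 * rename Fin.succ (C α * X 0 + C β * X 1) +
          rename Fin.succ r) + rename Fin.succ c) = f := by
  obtain ⟨u, hvu, hu⟩ := exists_linearIndependent_pair_eval_eq_zero
    (g := ∑ i, C (v i) * pderiv i f) (d := 2) (v := v)
    (IsHomogeneous.sum _ _ _ fun i _ => by
      simpa using (isHomogeneous_C _ (v i)).mul (hfd.pderiv (i := i))) two_ne_zero hv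
  obtain ⟨M, hM, hM0, hM1⟩ := exists_isUnit_matrix_mulVec hvu
  obtain ⟨L, hL, hL', hLM⟩ := exists_algEquiv_symm_eq_bind₁ hM
  refine ⟨L, hL, hL', ?_⟩
  have hp : (L.symm f).IsHomogeneous 3 := isHomogeneous_map_algEquiv hL' hfd
  have hMv : M.mulVec (Pi.single 0 1) = v := by ext i; simp [hM0]
  have hMu : M.mulVec (Pi.single 1 1) = u := by ext i; simp [hM1]
  have hp0 : coeff (Finsupp.single 0 3) (L.symm f) = 0 := by
    rw [← eval_single_of_isHomogeneous hp, hLM, eval_bind₁_toMvPolynomial, hMv, hvf]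
  have hp1 (j : Fin 4) (hj : j ≠ 0) :
      coeff (Finsupp.single 0 2 + Finsupp.single j 1) (L.symm f) = 0 := by
    have h := coeff_pderiv (i := j) (L.symm f) (Finsupp.single 0 2)
    rw [← eval_single_of_isHomogeneous hp.pderiv, hLM, eval_pderiv_bind₁_toMvPolynomial, hMv] at h
    simpa [hv', hj, hLM] using h.symm
  have hp2 : coeff (Finsupp.single 1 2 + Finsupp.single 0 1) (L.symm f) = 0 := by
    have h := coeff_pderiv (i := 0) (L.symm f) (Finsupp.single 1 2)
    rw [← eval_single_of_isHomogeneous hp.pderiv, hLM, eval_pderiv_bind₁_toMvPolynomial, hMu] at h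
    simp only [map_sum, map_mul, eval_C] at hu
    simpa [hM0, hu, hLM] using h.symm
  have hX : ∀ m : Fin (3 + 1) →₀ ℕ, 2 ≤ m 0 → coeff m (L.symm f) = 0 := by
    intro m hm
    by_contra hne
    have hd := degree_eq_of_coeff_ne_zero hp hne
    rw [Finsupp.degree_eq_sum, Fin.sum_univ_four] at hd
    have hm' : m = Finsupp.single 0 3 ∨ ∃ j, j ≠ 0 ∧
        m = Finsupp.single 0 2 + Finsupp.single j 1 := by
      have : (m 0 = 3 ∧ m 1 = 0 ∧ m 2 = 0 ∧ m 3 = 0) ∨ (m 0 = 2 ∧ m 1 = 1 ∧ m 2 = 0 ∧ m 3 = 0) ∨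
        (m 0 = 2 ∧ m 1 = 0 ∧ m 2 = 1 ∧ m 3 = 0) ∨ (m 0 = 2 ∧ m 1 = 0 ∧ m 2 = 0 ∧ m 3 = 1) := by
        omega
      rcases this with ⟨h0, h1, h2, h3⟩ | ⟨h0, h1, h2, h3⟩ | ⟨h0, h1, h2, h3⟩ | ⟨h0, h1, h2, h3⟩
      · left
        ext i; fin_cases i <;> simp [*]
      · refine Or.inr ⟨1, by decide, ?_⟩
        ext i; fin_cases i <;> simp [*]
      · refine Or.inr ⟨2, by decide, ?_⟩
        ext i; fin_cases i <;> simp [*]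
      · refine Or.inr ⟨3, by decide, ?_⟩
        ext i; fin_cases i <;> simp [*]
    rcases hm' with rfl | ⟨j, hj, rfl⟩
    · exact hne hp0
    · exact hne (hp1 j hj)
  obtain ⟨q, c, hq, hc, hqp, hpqc⟩ := exists_eq_X_zero_mul_add hp hX
  have hqX : ∀ m : Fin (2 + 1) →₀ ℕ, 2 ≤ m 0 → coeff m q = 0 := by
    intro m hm
    by_contra hne
    have hd := degree_eq_of_coeff_ne_zero hq hne
    rw [Finsupp.degree_eq_sum, Fin.sum_univ_three] at hd
    rw [hqp] at hne
    apply hne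
    rw [← hp2]
    congr 1
    have h0 : m 0 = 2 := by omega
    have h1 : m 1 = 0 := by omega
    have h2 : m 2 = 0 := by omega
    ext i
    refine Fin.cases ?_ (fun i => ?_) i
    · simp
    · rw [Finsupp.cons_succ]
      fin_cases i <;> simp [*]
  obtain ⟨l, r, hl, hr, -, hqlr⟩ := exists_eq_X_zero_mul_add hq hqX
  obtain ⟨α, β, rfl⟩ := exists_eq_of_isHomogeneous_one hl
  exact ⟨α, β, r, c, hr, hc, by rw [← hqlr, ← hpqc, L.apply_symm_apply]⟩

end Coordinates

/-- **Proposition 5.12.**  Let `k` be algebraically closed and let `X = V(f) ⊆ ℙ³_k`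
be a singular irreducible cubic hypersurface (singular: there is a nontrivial common
zero of `f` and all its partial derivatives).  Then there is an automorphism `φ` of
the variety `ℙ³_k ∖ X` that does not extend to an automorphism of `ℙ³_k`. -/
theorem stmt19 (k : Type) [Field k] [IsAlgClosed k]
    (f : MvPolynomial (Fin (3 + 1)) k)
    (hf : Irreducible f) (hfd : f.IsHomogeneous 3)
    (hsing : ∃ v : Fin (3 + 1) → k, v ≠ 0 ∧ eval v f = 0 ∧
      ∀ i, eval v (pderiv i f) = 0) :
    ∃ φ : PnF k 3 f ≅ PnF k 3 f,
      -- `φ` is an automorphism of the variety `ℙ³_f = ℙ³ ∖ X` over `k` …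
      φ.hom ≫ PnFStruct k 3 f = PnFStruct k 3 f ∧
      -- … that does not extend to an automorphism of `ℙ³_k`:
      ¬ ∃ Φ : ProjSpace k 3 ≅ ProjSpace k 3,
          Φ.hom ≫ projStruct k 3 = projStruct k 3 ∧
          (Proj.basicOpen (grading k 3) f).ι ≫ Φ.hom
            = φ.hom ≫ (Proj.basicOpen (grading k 3) f).ι := by
  obtain ⟨v, hv, hvf, hv'⟩ := hsing
  obtain ⟨L, hLX, hL', α, β, r, c, hr, hc, hL⟩ := exists_normal_form hfd hv hvf hv'
  by_cases hαβ : α ≠ 0 ∨ β ≠ 0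
  · exact HasNonextendingAutomorphism.of_quadric hf hfd hLX hL' hαβ hr hc hL
  obtain ⟨rfl, rfl⟩ : α = 0 ∧ β = 0 := by tauto
  rw [C_0, zero_mul, zero_mul, add_zero, map_zero, mul_zero, zero_add] at hL
  rcases eq_or_ne r 0 with rfl | hr0
  · rw [map_zero, map_zero, mul_zero, zero_add] at hL
    exact HasNonextendingAutomorphism.of_cone hf hfd hLX hL' hL
  · exact HasNonextendingAutomorphism.of_quadric_cone hf hfd hLX hL' hr hr0 hc hL

end
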